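/- arXiv:2010.15650 — 2 statements merged into one kernel-verified Lean document; each statement's English description precedes it below -/
import Mathlib

section
/- Let G be a finite connected simple graph and c₀ an initial configuration from which chip-firing terminates. For every vertex k and every 1 ≤ j ≤ N(k), there exists a configuration reachable from c₀ in which the only vertex ready to fire is k and exactly j−1 firings at k have occurred in reaching it (so the only available firing move is the j-th firing at k). -/
/-!  Chip-firing on a finite simple graph. -/

/-- One chip-firing move at vertex `k`: `k` loses `deg k` chips and each of its
neighbors gains one chip. -/
def gfire {V : Type*} [Fintype V] [DecidableEq V] (G : SimpleGraph V) [DecidableRel G.Adj]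
    (c : V → ℕ) (k : V) : V → ℕ :=
  fun v => if v = k then c k - G.degree k else if G.Adj k v then c v + 1 else c v

/-- Apply a list of firing moves in order. -/
def gapply {V : Type*} [Fintype V] [DecidableEq V] (G : SimpleGraph V) [DecidableRel G.Adj]
    (c : V → ℕ) : List V → (V → ℕ)
  | [] => c
  | k :: s => gapply G (gfire G c k) s

/-- The list of vertices `s` is a legal firing sequence from `c`: every fired vertex
has at least as many chips as its degree at the moment it is fired. -/
def GLegal {V : Type*} [Fintype V] [DecidableEq V] (G : SimpleGraph V) [DecidableRel G.Adj]
    (c : V → ℕ) : List V → Prop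
  | [] => True
  | k :: s => G.degree k ≤ c k ∧ GLegal G (gfire G c k) s

/-- `c₂` is reachable from `c₁` by a sequence of firing moves. -/
def GReachable {V : Type*} [Fintype V] [DecidableEq V] (G : SimpleGraph V) [DecidableRel G.Adj]
    (c₁ c₂ : V → ℕ) : Prop :=
  ∃ s, GLegal G c₁ s ∧ gapply G c₁ s = c₂

/-- Vertex `k` is ready to fire in `c`. -/
def GReady {V : Type*} [Fintype V] [DecidableEq V] (G : SimpleGraph V) [DecidableRel G.Adj]
    (c : V → ℕ) (k : V) : Prop := G.degree k ≤ c k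

/-- No vertex is ready to fire in `c`. -/
def GStable {V : Type*} [Fintype V] [DecidableEq V] (G : SimpleGraph V) [DecidableRel G.Adj]
    (c : V → ℕ) : Prop := ∀ k, c k < G.degree k

/-- Some legal firing sequence from `c₀` performs the `j'`-th firing at `k'`
strictly before the `j`-th firing at `k`: there is a legal sequence with a prefix `t`
containing exactly `j' - 1` firings at `k'` and fewer than `j` firings at `k`,
immediately followed by a firing at `k'`. -/
def GFiresBefore {V : Type*} [Fintype V] [DecidableEq V] (G : SimpleGraph V) [DecidableRel G.Adj]
    (c₀ : V → ℕ) (k' : V) (j' : ℕ) (k : V) (j : ℕ) : Prop :=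
  ∃ t u : List V, GLegal G c₀ (t ++ k' :: u) ∧ t.count k' = j' - 1 ∧ t.count k < j

/-- The move-poset order: move `p = (k, j)` (the `j`-th firing at `k`) satisfies `p ≥ q`
iff `p = q` or no legal firing sequence from `c₀` performs move `q` strictly before `p`. -/
def GMoveGE {V : Type*} [Fintype V] [DecidableEq V] (G : SimpleGraph V) [DecidableRel G.Adj]
    (c₀ : V → ℕ) (p q : V × ℕ) : Prop :=
  p = q ∨ ¬ GFiresBefore G c₀ q.1 q.2 p.1 p.2

section ChipFiring

variable {V : Type*} [Fintype V] [DecidableEq V] (G : SimpleGraph V) [DecidableRel G.Adj]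

theorem gLegal_append (c : V → ℕ) (s t : List V) :
    GLegal G c (s ++ t) ↔ GLegal G c s ∧ GLegal G (gapply G c s) t := by
  induction s generalizing c with
  | nil => simp [GLegal, gapply]
  | cons k s ih => simp [GLegal, gapply, ih, and_assoc]

theorem gLegal_concat (c : V → ℕ) (s : List V) (k : V) :
    GLegal G c (s ++ [k]) ↔ GLegal G c s ∧ GReady G (gapply G c s) k := by
  simp [gLegal_append, GLegal, GReady]

variable {G}

/-- Conservation of chips at a vertex along a single firing. -/
theorem gfire_add {c : V → ℕ} {k : V} (h : GReady G c k) (v : V) :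
    gfire G c k v + (if k = v then G.degree v else 0) =
      c v + if k ∈ G.neighborFinset v then 1 else 0 := by
  unfold GReady at h
  by_cases hkv : k = v
  · subst hkv
    simp [gfire, h]
  · have hvk : v ≠ k := Ne.symm hkv
    by_cases hadj : G.Adj k v <;> simp [gfire, hkv, hvk, hadj, G.adj_comm v k]

/-- Conservation of chips at a vertex along a legal firing sequence. -/
theorem GLegal.gapply_add_degree_mul_count {c : V → ℕ} {s : List V} (h : GLegal G c s) (v : V) :
    gapply G c s v + G.degree v * s.count v =
      c v + ∑ u ∈ G.neighborFinset v, s.count u := by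
  induction s generalizing c with
  | nil => simp [gapply]
  | cons k s ih =>
    have hrest := ih h.2
    have hfire := gfire_add h.1 v
    simp only [List.count_cons, beq_iff_eq, Finset.sum_add_distrib, Finset.sum_ite_eq, mul_add,
      mul_ite, mul_one, mul_zero, gapply]
    omega

/-- Least action principle: no legal firing sequence fires a vertex more often than a legal
firing sequence that ends in a stable configuration. -/
theorem GLegal.count_le_of_gStable {c : V → ℕ} {s t : List V} (hs : GLegal G c s)
    (ht : GLegal G c t) (hstable : GStable G (gapply G c t)) (v : V) :
    s.count v ≤ t.count v := by
  induction s using List.reverseRecOn generalizing v with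
  | nil => simp
  | append_singleton s k ih =>
    obtain ⟨hs, hk⟩ := (gLegal_concat G c s k).1 hs
    have hle := ih hs
    by_cases hkv : k = v
    · subst hkv
      rw [List.count_append, List.count_singleton_self, Nat.add_one_le_iff]
      refine lt_of_le_of_ne (hle k) fun heq => ?_
      have hsum : ∑ u ∈ G.neighborFinset k, s.count u ≤ ∑ u ∈ G.neighborFinset k, t.count u :=
        Finset.sum_le_sum fun u _ => hle u
      have hchips_s := hs.gapply_add_degree_mul_count k
      have hchips_t := ht.gapply_add_degree_mul_count k
      rw [heq] at hchips_s
      have hlt := hstable k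
      unfold GReady at hk
      omega
    · simpa [List.count_append, List.count_singleton, hkv] using hle v

theorem GLegal.length_le_of_gStable {c : V → ℕ} {s t : List V} (hs : GLegal G c s)
    (ht : GLegal G c t) (hstable : GStable G (gapply G c t)) : s.length ≤ t.length :=
  (List.subperm_ext_iff.2 fun v _ => hs.count_le_of_gStable ht hstable v).length_le

/-- A legal firing sequence has an initial part that fires `k` any prescribed smaller number
of times. -/
theorem GLegal.exists_count_eq {c : V → ℕ} {s : List V} (hs : GLegal G c s) {k : V} {m : ℕ}
    (hm : m ≤ s.count k) : ∃ t, GLegal G c t ∧ t.count k = m := by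
  induction s using List.reverseRecOn with
  | nil => exact ⟨[], hs, by simpa using hm.antisymm' (Nat.zero_le _)⟩
  | append_singleton s a ih =>
    by_cases hlt : m ≤ s.count k
    · exact ih ((gLegal_concat G c s a).1 hs).1 hlt
    · refine ⟨_, hs, le_antisymm ?_ hm⟩
      have hone : [a].count k ≤ 1 := List.count_le_length
      rw [List.count_append]
      omega

/-- If firing terminates, a legal firing sequence can be continued without firing `k` until no
vertex other than `k` is ready. -/
theorem GLegal.exists_forall_ready_eq {c : V → ℕ} {s t : List V} (hs : GLegal G c s)
    (ht : GLegal G c t) (hstable : GStable G (gapply G c t)) (k : V) :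
    ∃ r, GLegal G c r ∧ r.count k = s.count k ∧ ∀ v, GReady G (gapply G c r) v → v = k := by
  by_contra! hcon
  have hlong : ∀ n, ∃ r, GLegal G c r ∧ r.count k = s.count k ∧ n ≤ r.length := by
    intro n
    induction n with
    | zero => exact ⟨s, hs, rfl, Nat.zero_le _⟩
    | succ n ih =>
      obtain ⟨r, hr, hcount, hlen⟩ := ih
      obtain ⟨v, hv, hvk⟩ := hcon r hr hcount
      exact ⟨r ++ [v], (gLegal_concat G c r v).2 ⟨hr, hv⟩,
        by simp [List.count_append, hvk, hcount], by simpa using hlen⟩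
  obtain ⟨r, hr, -, hlen⟩ := hlong (t.length + 1)
  have hle := hr.length_le_of_gStable ht hstable
  omega

end ChipFiring

/-- For every vertex `k` and every `1 ≤ j ≤ N k`, there is a
configuration reachable from `c₀` in which the only vertex ready to fire is `k` and
exactly `j - 1` firings at `k` have occurred in reaching it. -/
theorem exists_config_unique_available_move
    {V : Type*} [Fintype V] [DecidableEq V] (G : SimpleGraph V) [DecidableRel G.Adj]
    (hG : G.Connected) (c₀ : V → ℕ)
    (hterm : ∃ s, GLegal G c₀ s ∧ GStable G (gapply G c₀ s))
    (N : V → ℕ)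
    (hN : ∀ s, GLegal G c₀ s → GStable G (gapply G c₀ s) → ∀ k, s.count k = N k)
    (k : V) (j : ℕ) (hj1 : 1 ≤ j) (hj2 : j ≤ N k) :
    ∃ c : V → ℕ, ∃ s : List V,
      GLegal G c₀ s ∧ gapply G c₀ s = c ∧ s.count k = j - 1 ∧
        (∀ v, GReady G c v ↔ v = k) := by
  obtain ⟨t, ht, hstable⟩ := hterm
  have hle : j - 1 ≤ t.count k := by
    rw [hN t ht hstable k]
    omega
  obtain ⟨s, hs, hcount⟩ := ht.exists_count_eq hle
  obtain ⟨r, hr, hrcount, hready⟩ := hs.exists_forall_ready_eq ht hstable k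
  refine ⟨_, r, hr, rfl, hrcount.trans hcount, fun v => ⟨hready v, ?_⟩⟩
  rintro rfl
  by_contra hnot
  have hrstable : GStable G (gapply G c₀ r) := by
    intro u
    by_contra hu
    have hu' : GReady G (gapply G c₀ r) u := not_lt.1 hu
    exact hnot (hready u hu' ▸ hu')
  have hNr := hN r hr hrstable v
  omega
end

section
/- For chip-firing on the line starting from the endgame configuration c₀ with n = 2m chips, the configuration poset is a lattice in which, for reachable configurations c₁ and c₂, the join c₁ ∨ c₂ is the unique reachable configuration c₃ with mv(c₃) = mv(c₁) ∩ mv(c₂), and the meet c₁ ∧ c₂ is the unique reachable configuration c₄ with mv(c₄) = mv(c₁) ∪ mv(c₂). -/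
/-!  Chip-firing on the line (the 1-dimensional grid ℤ). -/

/-- One chip-firing move at site `k` on the line: site `k` loses two chips and each of
its two neighbors gains one chip. -/
def lfire (c : ℤ → ℕ) (k : ℤ) : ℤ → ℕ :=
  fun i => if i = k then c k - 2 else if i = k - 1 ∨ i = k + 1 then c i + 1 else c i

/-- Apply a list of firing moves in order. -/
def lapply (c : ℤ → ℕ) : List ℤ → (ℤ → ℕ)
  | [] => c
  | k :: s => lapply (lfire c k) s

/-- The list of sites `s` is a legal firing sequence from `c`: every fired site has
at least 2 chips at the moment it is fired. -/
def LLegal (c : ℤ → ℕ) : List ℤ → Prop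
  | [] => True
  | k :: s => 2 ≤ c k ∧ LLegal (lfire c k) s

/-- `c₂` is reachable from `c₁` by a sequence of firing moves. -/
def LReachable (c₁ c₂ : ℤ → ℕ) : Prop :=
  ∃ s, LLegal c₁ s ∧ lapply c₁ s = c₂

/-- No site is ready to fire in `c`. -/
def LStable (c : ℤ → ℕ) : Prop := ∀ k, c k < 2

/-- The set `mv` of moves performed by the firing sequence `s`: the pair `(k, j)`
denotes the `j`-th firing at site `k`. -/
def Mv (s : List ℤ) : Set (ℤ × ℕ) := {p | 1 ≤ p.2 ∧ p.2 ≤ s.count p.1}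

/-- Some legal firing sequence from `c₀` performs the `j'`-th firing at `k'` strictly
before the `j`-th firing at `k`: there is a legal sequence with a prefix `t` containing
exactly `j' - 1` firings at `k'` and fewer than `j` firings at `k`, immediately followed
by a firing at `k'`. -/
def LFiresBefore (c₀ : ℤ → ℕ) (k' : ℤ) (j' : ℕ) (k : ℤ) (j : ℕ) : Prop :=
  ∃ t u : List ℤ, LLegal c₀ (t ++ k' :: u) ∧ t.count k' = j' - 1 ∧ t.count k < j

/-- The move-poset order: move `p = (k, j)` (the `j`-th firing at `k`) satisfies `p ≥ q`
iff `p = q` or no legal firing sequence from `c₀` performs move `q` strictly before `p`. -/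
def LMoveGE (c₀ : ℤ → ℕ) (p q : ℤ × ℕ) : Prop :=
  p = q ∨ ¬ LFiresBefore c₀ q.1 q.2 p.1 p.2

/-- The endgame configuration with `n = 2m` chips: two chips at the origin and one chip
at each site `i` with `1 ≤ |i| ≤ m - 1`. -/
def endgame (m : ℕ) : ℤ → ℕ :=
  fun i => if i = 0 then 2 else if |i| ≤ (m : ℤ) - 1 then 1 else 0

/-- `j` is the join (least upper bound) of `a` and `b` in the configuration poset of
configurations reachable from `c₀`, ordered by `c ≥ c'` iff `c'` is reachable from `c`. -/
def LIsJoin (c₀ a b j : ℤ → ℕ) : Prop :=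
  LReachable c₀ j ∧ LReachable j a ∧ LReachable j b ∧
    ∀ c, LReachable c₀ c → LReachable c a → LReachable c b → LReachable c j

/-- `mt` is the meet (greatest lower bound) of `a` and `b` in the configuration poset of
configurations reachable from `c₀`, ordered by `c ≥ c'` iff `c'` is reachable from `c`. -/
def LIsMeet (c₀ a b mt : ℤ → ℕ) : Prop :=
  LReachable c₀ mt ∧ LReachable a mt ∧ LReachable b mt ∧
    ∀ c, LReachable c₀ c → LReachable a c → LReachable b c → LReachable mt c

theorem lapply_append (c : ℤ → ℕ) (s t : List ℤ) :
    lapply c (s ++ t) = lapply (lapply c s) t := by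
  induction s generalizing c with
  | nil => rfl
  | cons k s ih => exact ih _

theorem lLegal_append (c : ℤ → ℕ) (s t : List ℤ) :
    LLegal c (s ++ t) ↔ LLegal c s ∧ LLegal (lapply c s) t := by
  induction s generalizing c with
  | nil => simp [LLegal, lapply]
  | cons k s ih => simp [LLegal, lapply, ih, and_assoc]

theorem LLegal.lapply_eq {c : ℤ → ℕ} {s : List ℤ} (h : LLegal c s) (i : ℤ) :
    (lapply c s i : ℤ) = c i - 2 * s.count i + s.count (i - 1) + s.count (i + 1) := by
  induction s generalizing c with
  | nil => simp [lapply]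
  | cons k s ih =>
    obtain ⟨hk, hs⟩ := h
    rw [lapply, ih hs]
    simp only [lfire, List.count_cons, beq_iff_eq]
    grind

theorem LLegal.lapply_congr {c : ℤ → ℕ} {s t : List ℤ} (hs : LLegal c s) (ht : LLegal c t)
    (h : ∀ k, s.count k = t.count k) : lapply c s = lapply c t := by
  funext i
  have h₁ := hs.lapply_eq i
  have h₂ := ht.lapply_eq i
  rw [h, h, h, ← h₂] at h₁
  exact_mod_cast h₁

/-- The firing vectors of the legal sequences from `endgame m`: they vanish outside `|k| < m`
and decrease in steps of size at most one when moving away from the origin. -/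
structure EndgameAdm (m : ℕ) (f : ℤ → ℕ) : Prop where
  eq_zero : ∀ k, (m : ℤ) ≤ |k| → f k = 0
  right : ∀ k, 0 < k → f k ≤ f (k - 1) ∧ f (k - 1) ≤ f k + 1
  left : ∀ k, k < 0 → f k ≤ f (k + 1) ∧ f (k + 1) ≤ f k + 1

theorem EndgameAdm.min {m : ℕ} {f g : ℤ → ℕ} (hf : EndgameAdm m f) (hg : EndgameAdm m g) :
    EndgameAdm m (fun k => min (f k) (g k)) where
  eq_zero k hk := by simp [hf.eq_zero k hk]
  right k hk := by have := hf.right k hk; have := hg.right k hk; omega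
  left k hk := by have := hf.left k hk; have := hg.left k hk; omega

theorem EndgameAdm.max {m : ℕ} {f g : ℤ → ℕ} (hf : EndgameAdm m f) (hg : EndgameAdm m g) :
    EndgameAdm m (fun k => max (f k) (g k)) where
  eq_zero k hk := by simp [hf.eq_zero k hk, hg.eq_zero k hk]
  right k hk := by have := hf.right k hk; have := hg.right k hk; omega
  left k hk := by have := hf.left k hk; have := hg.left k hk; omega

theorem LLegal.endgameAdm {m : ℕ} (hm : 1 ≤ m) {s : List ℤ} (h : LLegal (endgame m) s) :
    EndgameAdm m (fun k => s.count k) := by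
  induction s using List.reverseRecOn with
  | nil => constructor <;> simp
  | append_singleton s k ih =>
    obtain ⟨hs, hk, -⟩ := (lLegal_append _ _ _).1 h
    have ih := ih hs
    have hc := hs.lapply_eq k
    have h₀ := ih.eq_zero k
    have hr := ih.right k
    have hr' := ih.right (k + 1)
    have hl := ih.left k
    have hl' := ih.left (k - 1)
    simp only [add_sub_cancel_right, sub_add_cancel] at h₀ hr hr' hl hl'
    have hkm : |k| < m := by
      by_contra! hkm
      have := h₀ hkm
      simp only [endgame] at hc
      split_ifs at hc <;> grind
    simp only [endgame] at hc
    constructor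
    · intro i hi
      have := ih.eq_zero i hi
      have : k ≠ i := by grind
      simp_all
    · intro i hi
      have := ih.right i hi
      simp only [List.count_append, List.count_singleton, beq_iff_eq]
      grind
    · intro i hi
      have := ih.left i hi
      simp only [List.count_append, List.count_singleton, beq_iff_eq]
      grind

/-- A firing vector strictly below an admissible one can be increased towards it by a legal
firing. -/
theorem LLegal.exists_fire {m : ℕ} (hm : 1 ≤ m) {s : List ℤ} (hs : LLegal (endgame m) s)
    {f : ℤ → ℕ} (hf : EndgameAdm m f) (hne : ∃ k, s.count k < f k) :
    ∃ k, s.count k < f k ∧ LLegal (endgame m) (s ++ [k]) := by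
  obtain ⟨k, hk, hmin⟩ := exists_minimalFor_of_wellFoundedLT
    (fun k => s.count k < f k) (fun k => 2 * s.count k + k.natAbs) hne
  refine ⟨k, hk, (lLegal_append _ _ _).2 ⟨hs, ?_, trivial⟩⟩
  have hg := hs.endgameAdm hm
  have hc := hs.lapply_eq k
  have h₁ := @hmin (k + 1)
  have h₂ := @hmin (k - 1)
  have hf₀ := hf.eq_zero k
  have hfr := hf.right k
  have hfr' := hf.right (k + 1)
  have hfl := hf.left k
  have hfl' := hf.left (k - 1)
  have hgr := hg.right k
  have hgr' := hg.right (k + 1)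
  have hgl := hg.left k
  have hgl' := hg.left (k - 1)
  simp only [add_sub_cancel_right, sub_add_cancel, endgame] at *
  rcases lt_trichotomy k 0 with h | h | h
  · grind
  · subst h
    simp only [zero_add, zero_sub, if_true] at *
    have := hfr' one_pos
    have := hfl' (by simp)
    have := hgr' one_pos
    have := hgl' (by simp)
    simp only [Int.natAbs_zero, Int.natAbs_one, Int.natAbs_neg] at h₁ h₂
    by_contra!
    by_cases hr : s.count 1 < s.count 0
    · have := h₁ (by omega) (by omega)
      omega
    · have := h₂ (by omega) (by omega)
      omega
  · grind

theorem LLegal.exists_extend {m : ℕ} (hm : 1 ≤ m) {f : ℤ → ℕ} (hf : EndgameAdm m f)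
    {s : List ℤ} (hs : LLegal (endgame m) s) (hle : ∀ k, s.count k ≤ f k) :
    ∃ t, LLegal (endgame m) (s ++ t) ∧ ∀ k, (s ++ t).count k = f k := by
  induction hn : ∑ k ∈ Finset.Icc (-m : ℤ) m, (f k - s.count k) using Nat.strong_induction_on
    generalizing s with
  | _ n ih =>
    by_cases hne : ∃ k, s.count k < f k
    · obtain ⟨k, hk, hl⟩ := hs.exists_fire hm hf hne
      have hcount : ∀ i, (s ++ [k]).count i = s.count i + if k = i then 1 else 0 := by
        intro i
        simp [List.count_singleton]
      have hkm : k ∈ Finset.Icc (-m : ℤ) m := by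
        have := hf.eq_zero k
        rw [Finset.mem_Icc]
        grind
      obtain ⟨t, ht, htf⟩ := ih _ (by
        rw [← hn]
        refine Finset.sum_lt_sum (fun i _ => ?_) ⟨k, hkm, ?_⟩
        · rw [hcount]; omega
        · rw [hcount, if_pos rfl]; omega) hl (fun i => by
          have := hle i
          rw [hcount]; grind) rfl
      exact ⟨k :: t, by simpa using ht, by simpa using htf⟩
    · push Not at hne
      exact ⟨[], by simpa using hs, fun k => by simpa using (hle k).antisymm (hne k)⟩

theorem LLegal.lReachable_of_count_le {m : ℕ} (hm : 1 ≤ m) {s t : List ℤ}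
    (hs : LLegal (endgame m) s) (ht : LLegal (endgame m) t)
    (hle : ∀ k, s.count k ≤ t.count k) :
    LReachable (lapply (endgame m) s) (lapply (endgame m) t) := by
  obtain ⟨u, hu, hut⟩ := hs.exists_extend hm (ht.endgameAdm hm) hle
  refine ⟨u, ((lLegal_append _ _ _).1 hu).2, ?_⟩
  rw [← lapply_append]
  exact hu.lapply_congr ht hut

theorem LLegal.count_eq_of_lapply_eq {m : ℕ} (hm : 1 ≤ m) {s t : List ℤ}
    (hs : LLegal (endgame m) s) (ht : LLegal (endgame m) t)
    (h : lapply (endgame m) s = lapply (endgame m) t) (k : ℤ) : s.count k = t.count k := by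
  have hout : ∀ k : ℤ, (m : ℤ) ≤ k → s.count k = t.count k := fun k hk => by
    have hk' := hk.trans (le_abs_self k)
    exact ((hs.endgameAdm hm).eq_zero k hk').trans ((ht.endgameAdm hm).eq_zero k hk').symm
  have hdown : ∀ n : ℕ, s.count (m - n : ℤ) = t.count (m - n : ℤ) ∧
      s.count (m - n + 1 : ℤ) = t.count (m - n + 1 : ℤ) := by
    intro n
    induction n with
    | zero => exact ⟨hout _ (by simp), hout _ (by simp)⟩
    | succ n ih =>
      have h₁ := hs.lapply_eq (m - n)
      have h₂ := ht.lapply_eq (m - n)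
      rw [h] at h₁
      have e₁ : (m - (n + 1 : ℕ) : ℤ) = m - n - 1 := by push_cast; ring
      have e₂ : (m - n - 1 + 1 : ℤ) = m - n := by ring
      rw [e₁, e₂]
      omega
  rcases le_total (m : ℤ) k with hk | hk
  · exact hout k hk
  · have := (hdown (m - k).toNat).1
    rwa [Int.toNat_of_nonneg (by omega), sub_sub_cancel] at this

theorem LLegal.count_le_of_lReachable {m : ℕ} (hm : 1 ≤ m) {s t : List ℤ}
    (hs : LLegal (endgame m) s) (ht : LLegal (endgame m) t)
    (h : LReachable (lapply (endgame m) s) (lapply (endgame m) t)) (k : ℤ) :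
    s.count k ≤ t.count k := by
  obtain ⟨u, hu, hut⟩ := h
  rw [← ((lLegal_append _ _ _).2 ⟨hs, hu⟩).count_eq_of_lapply_eq hm ht
    (by rw [lapply_append, hut]) k, List.count_append]
  exact Nat.le_add_right _ _

theorem count_eq_of_mv_eq {s t : List ℤ} (h : Mv s = Mv t) (k : ℤ) : s.count k = t.count k := by
  have key : ∀ j, 1 ≤ j ∧ j ≤ s.count k ↔ 1 ≤ j ∧ j ≤ t.count k := fun j =>
    Set.ext_iff.1 h (k, j)
  have h₁ := key (s.count k)
  have h₂ := key (t.count k)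
  omega

theorem mv_eq_inter {s t u : List ℤ} (h : ∀ k, u.count k = min (s.count k) (t.count k)) :
    Mv u = Mv s ∩ Mv t := by
  ext ⟨k, j⟩
  simp only [Mv, Set.mem_ofPred_eq, Set.mem_inter_iff, h]
  omega

theorem mv_eq_union {s t u : List ℤ} (h : ∀ k, u.count k = max (s.count k) (t.count k)) :
    Mv u = Mv s ∪ Mv t := by
  ext ⟨k, j⟩
  simp only [Mv, Set.mem_ofPred_eq, Set.mem_union, h]
  omega

/-- For chip-firing on the line from the endgame configuration with
`n = 2m` chips, the configuration poset is a lattice: the join `c₁ ∨ c₂` is the unique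
reachable configuration `c₃` with `mv(c₃) = mv(c₁) ∩ mv(c₂)`, and the meet `c₁ ∧ c₂` is
the unique reachable configuration `c₄` with `mv(c₄) = mv(c₁) ∪ mv(c₂)`. -/
theorem endgame_config_poset_lattice
    (m : ℕ) (hm : 1 ≤ m) (c₀ : ℤ → ℕ) (hc₀ : c₀ = endgame m)
    (c₁ c₂ : ℤ → ℕ) (s₁ s₂ : List ℤ)
    (hs₁ : LLegal c₀ s₁) (hc₁ : lapply c₀ s₁ = c₁)
    (hs₂ : LLegal c₀ s₂) (hc₂ : lapply c₀ s₂ = c₂) :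
    (∃ c₃ : ℤ → ℕ,
      (∃ s₃, LLegal c₀ s₃ ∧ lapply c₀ s₃ = c₃ ∧ Mv s₃ = Mv s₁ ∩ Mv s₂) ∧
      (∀ c₃' : ℤ → ℕ, ∀ s₃' : List ℤ, LLegal c₀ s₃' → lapply c₀ s₃' = c₃' →
        Mv s₃' = Mv s₁ ∩ Mv s₂ → c₃' = c₃) ∧
      LIsJoin c₀ c₁ c₂ c₃) ∧
    (∃ c₄ : ℤ → ℕ,
      (∃ s₄, LLegal c₀ s₄ ∧ lapply c₀ s₄ = c₄ ∧ Mv s₄ = Mv s₁ ∪ Mv s₂) ∧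
      (∀ c₄' : ℤ → ℕ, ∀ s₄' : List ℤ, LLegal c₀ s₄' → lapply c₀ s₄' = c₄' →
        Mv s₄' = Mv s₁ ∪ Mv s₂ → c₄' = c₄) ∧
      LIsMeet c₀ c₁ c₂ c₄) := by
  subst hc₀ hc₁ hc₂
  have hnil : LLegal (endgame m) [] := trivial
  have ha₁ := hs₁.endgameAdm hm
  have ha₂ := hs₂.endgameAdm hm
  constructor
  · obtain ⟨s₃, hs₃, hcount⟩ := hnil.exists_extend hm (ha₁.min ha₂) (by simp)
    rw [List.nil_append] at hs₃ hcount
    have hmv := mv_eq_inter hcount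
    refine ⟨_, ⟨s₃, hs₃, rfl, hmv⟩, ?_, ⟨s₃, hs₃, rfl⟩, ?_, ?_, ?_⟩
    · rintro _ s hs rfl h
      exact hs.lapply_congr hs₃ (count_eq_of_mv_eq (h.trans hmv.symm))
    · exact hs₃.lReachable_of_count_le hm hs₁ fun k => (hcount k).trans_le (min_le_left _ _)
    · exact hs₃.lReachable_of_count_le hm hs₂ fun k => (hcount k).trans_le (min_le_right _ _)
    · rintro _ ⟨s, hs, rfl⟩ h₁ h₂
      refine hs.lReachable_of_count_le hm hs₃ fun k => ?_
      rw [hcount]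
      exact le_min (hs.count_le_of_lReachable hm hs₁ h₁ k)
        (hs.count_le_of_lReachable hm hs₂ h₂ k)
  · obtain ⟨s₄, hs₄, hcount⟩ := hnil.exists_extend hm (ha₁.max ha₂) (by simp)
    rw [List.nil_append] at hs₄ hcount
    have hmv := mv_eq_union hcount
    refine ⟨_, ⟨s₄, hs₄, rfl, hmv⟩, ?_, ⟨s₄, hs₄, rfl⟩, ?_, ?_, ?_⟩
    · rintro _ s hs rfl h
      exact hs.lapply_congr hs₄ (count_eq_of_mv_eq (h.trans hmv.symm))
    · exact hs₁.lReachable_of_count_le hm hs₄ fun k => (le_max_left _ _).trans_eq (hcount k).symm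
    · exact hs₂.lReachable_of_count_le hm hs₄ fun k => (le_max_right _ _).trans_eq (hcount k).symm
    · rintro _ ⟨s, hs, rfl⟩ h₁ h₂
      refine hs₄.lReachable_of_count_le hm hs fun k => ?_
      rw [hcount]
      exact max_le (hs₁.count_le_of_lReachable hm hs h₁ k)
        (hs₂.count_le_of_lReachable hm hs h₂ k)
end
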